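/- For s ∈ (1,∞), if f : U₁ → U₂ is a locally 𝒞^s map between open subsets of ℝ^n that is also a C¹ diffeomorphism, then f^{−1} : U₂ → U₁ is a locally 𝒞^s map. -/

import Mathlib

open Set Metric ENNReal

noncomputable section

variable {E F : Type*} [NormedAddCommGroup E] [NormedSpace ℝ E]
  [NormedAddCommGroup F] [NormedSpace ℝ F]

/-- The Hölder norm `‖f‖_{C^{0,s}(Ω)} = sup_Ω ‖f‖ + sup_{x≠y} ‖x-y‖^{-s}‖f x - f y‖`,
valued in `ℝ≥0∞`. -/
noncomputable def holderNorm (s : ℝ) (Ω : Set E) (f : E → F) : ℝ≥0∞ :=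
  (⨆ x ∈ Ω, ENNReal.ofReal ‖f x‖) +
    ⨆ (x ∈ Ω) (y ∈ Ω) (_ : x ≠ y), ENNReal.ofReal (‖f x - f y‖ / ‖x - y‖ ^ s)

/-- The second-difference (Zygmund) seminorm
`sup_{h ≠ 0, x, x+h, x+2h ∈ Ω} |h|^{-s} ‖f(x+2h) - 2 f(x+h) + f x‖`. -/
noncomputable def secondDiff (s : ℝ) (Ω : Set E) (f : E → F) : ℝ≥0∞ :=
  ⨆ (x : E) (h : E) (_ : h ≠ 0) (_ : x ∈ Ω) (_ : x + h ∈ Ω) (_ : x + 2 • h ∈ Ω),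
    ENNReal.ofReal (‖f (x + 2 • h) - 2 • f (x + h) + f x‖ / ‖h‖ ^ s)

/-- The Zygmund norm of order `s ∈ (0,1]`:
`‖f‖_{𝒞^s(Ω)} = ‖f‖_{C^{0,s/2}(Ω)} + second difference seminorm`. -/
noncomputable def zygBase (s : ℝ) (Ω : Set E) (f : E → F) : ℝ≥0∞ :=
  holderNorm (s / 2) Ω f + secondDiff s Ω f

/-- The Hölder norm `‖f‖_{C^{m,s}(Ω)} = Σ_{|α| ≤ m} ‖∂^α f‖_{C^{0,s}(Ω)}`, where
derivatives of order `i` are packaged as the full `i`-th derivative. -/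
noncomputable def holderCm (m : ℕ) (s : ℝ) (Ω : Set E) (f : E → F) : ℝ≥0∞ :=
  ∑ i ∈ Finset.range (m + 1), holderNorm s Ω (iteratedFDerivWithin ℝ i f Ω)

/-- The Zygmund norm of order `s > 0`: writing `s = m + σ` with `m ∈ ℕ`, `σ ∈ (0,1]`,
`‖f‖_{𝒞^s(Ω)} = Σ_{|α| ≤ m} ‖∂^α f‖_{𝒞^σ(Ω)}`. -/
noncomputable def zygNorm (s : ℝ) (Ω : Set E) (f : E → F) : ℝ≥0∞ :=
  ∑ i ∈ Finset.range ⌈s⌉₊, zygBase (s - (⌈s⌉₊ - 1 : ℕ)) Ω (iteratedFDerivWithin ℝ i f Ω)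

/-- Membership in the Zygmund space `𝒞^s(Ω)`. -/
def MemZyg (s : ℝ) (Ω : Set E) (f : E → F) : Prop :=
  ContDiffOn ℝ (⌈s⌉₊ - 1 : ℕ) f Ω ∧ zygNorm s Ω f ≠ ⊤

end
/-- `f` is locally `𝒞^s` on `U`: every point of `U` has a ball inside `U` on which `f` lies
in the Zygmund space `𝒞^s`. -/
def LocZyg {E F : Type*} [NormedAddCommGroup E] [NormedSpace ℝ E]
    [NormedAddCommGroup F] [NormedSpace ℝ F] (s : ℝ) (U : Set E) (f : E → F) : Prop :=
  ∀ x ∈ U, ∃ ε > 0, Metric.ball x ε ⊆ U ∧ MemZyg s (Metric.ball x ε) f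

namespace ZygInv

set_option linter.unusedSectionVars false

open Filter Topology

section base
variable {E F G H : Type} [NormedAddCommGroup E] [NormedSpace ℝ E]
  [NormedAddCommGroup F] [NormedSpace ℝ F] [NormedAddCommGroup G] [NormedSpace ℝ G]
  [NormedAddCommGroup H] [NormedSpace ℝ H]

/-- Zygmund bounds of order `σ` with constant `C` on a set. -/
def ZB (σ C : ℝ) (s : Set E) (u : E → F) : Prop :=
  (∀ y ∈ s, ‖u y‖ ≤ C) ∧ (∀ y ∈ s, ∀ z ∈ s, ‖u y - u z‖ ≤ C * ‖y - z‖ ^ (σ / 2)) ∧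
    ∀ a ∈ s, ∀ b ∈ s, ∀ c ∈ s, a + c = b + b →
      ‖u a + u c - (u b + u b)‖ ≤ C * ‖b - a‖ ^ σ

/-- Zygmund bounds near a point. -/
def ZygAt (σ : ℝ) (u : E → F) (x : E) : Prop :=
  ∃ C ≥ 0, ∃ s ∈ 𝓝 x, ZB σ C s u

lemma ZB.mono {σ C C' : ℝ} {s t : Set E} {u : E → F} (h : ZB σ C s u) (hC : C ≤ C')
    (hts : t ⊆ s) : ZB σ C' t u := by
  obtain ⟨h1, h2, h3⟩ := h
  refine ⟨fun y hy => (h1 y (hts hy)).trans hC, fun y hy z hz => ?_, fun a ha b hb c hc e => ?_⟩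
  · exact (h2 y (hts hy) z (hts hz)).trans (by gcongr)
  · exact (h3 a (hts ha) b (hts hb) c (hts hc) e).trans (by gcongr)

lemma ZB.congr {σ C : ℝ} {s : Set E} {u v : E → F} (h : ZB σ C s u) (e : EqOn v u s) :
    ZB σ C s v := by
  obtain ⟨h1, h2, h3⟩ := h
  refine ⟨fun y hy => ?_, fun y hy z hz => ?_, fun a ha b hb c hc e' => ?_⟩
  · rw [e hy]; exact h1 y hy
  · rw [e hy, e hz]; exact h2 y hy z hz
  · rw [e ha, e hb, e hc]; exact h3 a ha b hb c hc e'

lemma ZygAt.congr {σ : ℝ} {x : E} {u v : E → F} (h : ZygAt σ u x) (e : v =ᶠ[𝓝 x] u) :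
    ZygAt σ v x := by
  obtain ⟨C, hC, s, hs, h⟩ := h
  exact ⟨C, hC, s ∩ {y | v y = u y}, inter_mem hs e,
    (h.mono le_rfl inter_subset_left).congr fun y hy => hy.2⟩

lemma ZygAt.pair {σ : ℝ} {x : E} {u : E → F} {v : E → G} (h : ZygAt σ u x) (h' : ZygAt σ v x) :
    ∃ C ≥ 0, ∃ s ∈ 𝓝 x, ZB σ C s u ∧ ZB σ C s v := by
  obtain ⟨C, hC, s, hs, h⟩ := h
  obtain ⟨C', hC', s', hs', h'⟩ := h'
  exact ⟨max C C', le_max_of_le_left hC, s ∩ s', inter_mem hs hs',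
    h.mono (le_max_left _ _) inter_subset_left, h'.mono (le_max_right _ _) inter_subset_right⟩

lemma ZygAt.continuousAt {σ : ℝ} (hσ : 0 < σ) {x : E} {u : E → F} (h : ZygAt σ u x) :
    ContinuousAt u x := by
  obtain ⟨C, hC, s, hs, h1, h2, h3⟩ := h
  rw [ContinuousAt, tendsto_iff_norm_sub_tendsto_zero]
  have hx := mem_of_mem_nhds hs
  refine squeeze_zero' (g := fun y => C * ‖y - x‖ ^ (σ / 2)) (Eventually.of_forall fun y => norm_nonneg _)
    (by filter_upwards [hs] with y hy using h2 y hy x hx) ?_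
  have : ContinuousAt (fun y : E => C * ‖y - x‖ ^ (σ / 2)) x := by
    refine continuousAt_const.mul (ContinuousAt.rpow_const (by fun_prop) (Or.inr (by positivity)))
  have h0 := this.tendsto
  simpa [Real.zero_rpow (by positivity : σ / 2 ≠ 0)] using h0

lemma ZygAt.add {σ : ℝ} {x : E} {u v : E → F} (h : ZygAt σ u x) (h' : ZygAt σ v x) :
    ZygAt σ (fun y => u y + v y) x := by
  obtain ⟨C, hC, s, hs, ⟨h1, h2, h3⟩, h1', h2', h3'⟩ := h.pair h'
  refine ⟨C + C, by positivity, s, hs, fun y hy => ?_, fun y hy z hz => ?_,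
    fun a ha b hb c hc e => ?_⟩
  · exact norm_add_le_of_le (h1 y hy) (h1' y hy)
  · rw [add_sub_add_comm, add_mul]
    exact norm_add_le_of_le (h2 y hy z hz) (h2' y hy z hz)
  · have : u a + v a + (u c + v c) - (u b + v b + (u b + v b)) =
      (u a + u c - (u b + u b)) + (v a + v c - (v b + v b)) := by abel
    rw [this, add_mul]
    exact norm_add_le_of_le (h3 a ha b hb c hc e) (h3' a ha b hb c hc e)

lemma ZygAt.isom {σ : ℝ} {x : E} {u : E → F} (L : F ≃ₗᵢ[ℝ] G) :
    ZygAt σ (fun y => L (u y)) x ↔ ZygAt σ u x := by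
  simp only [ZygAt, ZB, ← map_sub, ← map_add, LinearIsometryEquiv.norm_map]

lemma ZygAt.isom' {σ : ℝ} {x : E} {u : E → F} (L : F → G)
    (ha : ∀ a b, L (a + b) = L a + L b) (hn : ∀ a, ‖L a‖ = ‖a‖) :
    ZygAt σ (fun y => L (u y)) x ↔ ZygAt σ u x := by
  have hs : ∀ a b, L (a - b) = L a - L b := fun a b => by
    rw [eq_sub_iff_add_eq, ← ha, sub_add_cancel]
  simp only [ZygAt, ZB, ← hs, ← ha, hn]

lemma rpow_half_mul {t σ : ℝ} (ht : 0 ≤ t) (hσ : 0 < σ) : t ^ (σ / 2) * t ^ (σ / 2) = t ^ σ := by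
  rw [← Real.rpow_add_of_nonneg ht (by positivity) (by positivity)]; congr 1; ring

lemma ZygAt.bilin {σ : ℝ} (hσ : 0 < σ) {x : E} {u : E → F} {v : E → G} (B : F →L[ℝ] G →L[ℝ] H)
    (h : ZygAt σ u x) (h' : ZygAt σ v x) : ZygAt σ (fun y => B (u y) (v y)) x := by
  obtain ⟨C, hC, s, hs, ⟨h1, h2, h3⟩, h1', h2', h3'⟩ := h.pair h'
  have key : ∀ (p : F) (q : G) (P Q : ℝ), ‖p‖ ≤ P → ‖q‖ ≤ Q → ‖B p q‖ ≤ ‖B‖ * P * Q := by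
    intro p q P Q hp hq
    have : 0 ≤ P := (norm_nonneg p).trans hp
    exact (B.le_opNorm₂ p q).trans (by gcongr)
  have hN : 0 ≤ ‖B‖ * C * C := by positivity
  refine ⟨4 * (‖B‖ * C * C), by positivity, s, hs, fun y hy => ?_, fun y hy z hz => ?_,
    fun a ha b hb c hc e => ?_⟩
  · exact (key _ _ _ _ (h1 y hy) (h1' y hy)).trans (by linarith)
  · have e1 : B (u y) (v y) - B (u z) (v z) = B (u y - u z) (v y) + B (u z) (v y - v z) := by
      simp only [map_sub, sub_apply]; abel
    rw [e1]
    have ht : 0 ≤ ‖y - z‖ ^ (σ / 2) := by positivity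
    refine (norm_add_le_of_le (key _ _ _ _ (h2 y hy z hz) (h1' y hy))
      (key _ _ _ _ (h1 z hz) (h2' y hy z hz))).trans ?_
    nlinarith
  · have e2 : c - b = b - a := by rw [sub_eq_sub_iff_add_eq_add, ← e, add_comm]
    have e1 : B (u a) (v a) + B (u c) (v c) - (B (u b) (v b) + B (u b) (v b)) =
        B (u a + u c - (u b + u b)) (v b) + B (u b) (v a + v c - (v b + v b))
        + B (u a - u b) (v a - v b) + B (u c - u b) (v c - v b) := by
      simp only [map_sub, map_add, sub_apply, add_apply]
      abel
    rw [e1]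
    have g1 := h2 a ha b hb
    have g2 := h2 c hc b hb
    have g1' := h2' a ha b hb
    have g2' := h2' c hc b hb
    rw [norm_sub_rev a b] at g1 g1'
    rw [e2] at g2 g2'
    refine (norm_add_le_of_le (norm_add_le_of_le (norm_add_le_of_le
      (key _ _ _ _ (h3 a ha b hb c hc e) (h1' b hb))
      (key _ _ _ _ (h1 b hb) (h3' a ha b hb c hc e))) (key _ _ _ _ g1 g1'))
      (key _ _ _ _ g2 g2')).trans (le_of_eq ?_)
    rw [← rpow_half_mul (norm_nonneg (b - a)) hσ]
    ring

lemma ZygAt.inv {R : Type} [NormedRing R] [NormedAlgebra ℝ R] {σ : ℝ} (hσ : 0 < σ) {x : E}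
    {A I : E → R} (h : ZygAt σ A x) {M : ℝ} (hM : ∀ᶠ y in 𝓝 x, ‖I y‖ ≤ M)
    (hl : ∀ᶠ y in 𝓝 x, I y * A y = 1) (hr : ∀ᶠ y in 𝓝 x, A y * I y = 1) : ZygAt σ I x := by
  obtain ⟨C₀, hC₀, s₀, hs₀, h⟩ := h
  obtain ⟨C, hC, hCM, hCC⟩ : ∃ C, 0 ≤ C ∧ M ≤ C ∧ C₀ ≤ C :=
    ⟨max M C₀, le_max_of_le_right hC₀, le_max_left _ _, le_max_right _ _⟩
  set s := s₀ ∩ {y | ‖I y‖ ≤ M ∧ I y * A y = 1 ∧ A y * I y = 1} with hs_def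
  have hs : s ∈ 𝓝 x := inter_mem hs₀ (hM.and (hl.and hr))
  obtain ⟨h1, h2, h3⟩ := h.mono hCC (inter_subset_left : s ⊆ s₀)
  have hI : ∀ y ∈ s, ‖I y‖ ≤ C := fun y hy => hy.2.1.trans hCM
  have key : ∀ (p q r : R) (P Q T : ℝ), ‖p‖ ≤ P → ‖q‖ ≤ Q → ‖r‖ ≤ T → ‖p * q * r‖ ≤ P * Q * T := by
    intro p q r P Q T hp hq hr
    have := norm_nonneg p
    have := norm_nonneg q
    have : 0 ≤ P := by linarith
    have : 0 ≤ Q := by linarith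
    exact (norm_mul_le _ _).trans (mul_le_mul ((norm_mul_le _ _).trans (by gcongr)) hr
      (norm_nonneg _) (by positivity))
  have hd : ∀ y ∈ s, ∀ z ∈ s, I y - I z = -(I y * (A y - A z) * I z) := by
    intro y hy z hz
    rw [mul_sub, sub_mul, hy.2.2.1, mul_assoc, hz.2.2.2]; simp
  have hH : ∀ y ∈ s, ∀ z ∈ s, ‖I y - I z‖ ≤ C * (C * ‖y - z‖ ^ (σ / 2)) * C := by
    intro y hy z hz
    rw [hd y hy z hz, norm_neg]
    exact key _ _ _ _ _ _ (hI y hy) (h2 y hy z hz) (hI z hz)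
  refine ⟨C + C ^ 3 + 2 * C ^ 5, by positivity, s, hs, fun y hy => ?_, fun y hy z hz => ?_,
    fun a ha b hb c hc e => ?_⟩
  · have : 0 ≤ C ^ 3 + 2 * C ^ 5 := by positivity
    linarith [hI y hy]
  · refine (hH y hy z hz).trans ?_
    have : 0 ≤ (C + 2 * C ^ 5) * ‖y - z‖ ^ (σ / 2) := by positivity
    linarith
  · have e2 : c - b = b - a := by rw [sub_eq_sub_iff_add_eq_add, ← e, add_comm]
    have e1 : I a + I c - (I b + I b) = -(I b * (A a + A c - (A b + A b)) * I b)
        + -((I a - I b) * (A a - A b) * I b) + -((I c - I b) * (A c - A b) * I b) := by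
      have : I a + I c - (I b + I b) = (I a - I b) + (I c - I b) := by abel
      rw [this]
      conv_lhs => rw [hd a ha b hb, hd c hc b hb]
      noncomm_ring
    rw [e1]
    have g1 := h2 a ha b hb
    have g2 := h2 c hc b hb
    have g1' := hH a ha b hb
    have g2' := hH c hc b hb
    rw [norm_sub_rev a b] at g1 g1'
    rw [e2] at g2 g2'
    refine (norm_add_le_of_le (norm_add_le_of_le
      ((norm_neg _).le.trans (key _ _ _ _ _ _ (hI b hb) (h3 a ha b hb c hc e) (hI b hb)))
      ((norm_neg _).le.trans (key _ _ _ _ _ _ g1' g1 (hI b hb))))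
      ((norm_neg _).le.trans (key _ _ _ _ _ _ g2' g2 (hI b hb)))).trans ?_
    have : 0 ≤ C * ‖b - a‖ ^ σ := by positivity
    have r := rpow_half_mul (norm_nonneg (b - a)) hσ
    rw [← r] at this ⊢
    nlinarith

/-- Improvement of the Hölder exponent. -/
lemma holder_improve {σ γ C r : ℝ} (hγ : 0 < γ) (hγσ : γ ≤ σ) (hγ1 : γ < 1)
    (hC : 0 ≤ C) (hr : 0 < r) (hr1 : r ≤ 1) {x : E} {u : E → F} (h : ZB σ C (ball x r) u) :
    ∃ K ≥ 0, ∀ y ∈ ball x (r / 4), ∀ z ∈ ball x (r / 4), ‖u y - u z‖ ≤ K * ‖y - z‖ ^ γ := by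
  obtain ⟨h1, -, h3⟩ := h
  have h2γ : (2 : ℝ) ^ γ < 2 := by
    calc (2 : ℝ) ^ γ < 2 ^ (1 : ℝ) := Real.rpow_lt_rpow_of_exponent_lt (by norm_num) hγ1
      _ = 2 := by simp
  set K := max (2 * C / (r / 4) ^ γ) (C / (2 - 2 ^ γ)) with hK
  have hr4 : 0 < (r / 4) ^ γ := by positivity
  have hK0 : 0 ≤ K := le_max_of_le_left (by positivity)
  have hKa : 2 * C ≤ K * (r / 4) ^ γ := by
    rw [← div_le_iff₀ hr4]; exact le_max_left _ _
  have hKb : C ≤ K * (2 - 2 ^ γ) := by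
    rw [← div_le_iff₀ (by linarith)]; exact le_max_right _ _
  have main : ∀ k : ℕ, ∀ y ∈ ball x (r / 2), ∀ h : E, ‖h‖ < r / 2 → r / 4 ≤ 2 ^ k * ‖h‖ →
      ‖u (y + h) - u y‖ ≤ K * ‖h‖ ^ γ := by
    intro k
    have far : ∀ y ∈ ball x (r / 2), ∀ h : E, ‖h‖ < r / 2 → y + h ∈ ball x r := by
      intro y hy h hh
      rw [mem_ball, dist_eq_norm] at *
      calc ‖y + h - x‖ = ‖(y - x) + h‖ := by congr 1; abel
        _ ≤ ‖y - x‖ + ‖h‖ := norm_add_le _ _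
        _ < r := by linarith
    have big : ∀ y ∈ ball x (r / 2), ∀ h : E, ‖h‖ < r / 2 → r / 4 ≤ ‖h‖ →
      ‖u (y + h) - u y‖ ≤ K * ‖h‖ ^ γ := by
      intro y hy h hh hh'
      have hy' : y ∈ ball x r := ball_subset_ball (by linarith) hy
      have := norm_sub_le_of_le (h1 _ (far y hy h hh)) (h1 y hy')
      have : (r / 4) ^ γ ≤ ‖h‖ ^ γ := by gcongr
      nlinarith
    induction k with
    | zero => intro y hy h hh hh'; exact big y hy h hh (by simpa using hh')
    | succ k ih =>
      intro y hy h hh hh'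
      by_cases hbig : r / 4 ≤ ‖h‖
      · exact big y hy h hh hbig
      push Not at hbig
      have hy' : y ∈ ball x r := ball_subset_ball (by linarith) hy
      have n2 : ‖h + h‖ = 2 * ‖h‖ := by rw [← two_smul ℝ h, norm_smul]; simp
      have i1 := ih y hy (h + h) (by rw [n2]; linarith) (by rw [n2]; rw [pow_succ] at hh'; linarith)
      rw [n2, Real.mul_rpow (by norm_num) (norm_nonneg _)] at i1
      have i2 := h3 y hy' (y + h) (far y hy h hh) (y + (h + h))
        (far y hy _ (by rw [n2]; linarith)) (by abel)
      rw [add_sub_cancel_left] at i2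
      have i3 : ‖h‖ ^ σ ≤ ‖h‖ ^ γ := by
        rcases eq_or_lt_of_le (norm_nonneg h) with h0 | h0
        · rw [← h0, Real.zero_rpow (by linarith), Real.zero_rpow (by linarith)]
        · exact Real.rpow_le_rpow_of_exponent_ge h0 (by linarith) hγσ
      have e : (2 : ℝ) • (u (y + h) - u y) =
          (u (y + (h + h)) - u y) - (u y + u (y + (h + h)) - (u (y + h) + u (y + h))) := by
        rw [two_smul]; abel
      have i4 := norm_sub_le_of_le i1 i2
      rw [← e, norm_smul, Real.norm_eq_abs, abs_of_pos (by norm_num : (0:ℝ) < 2)] at i4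
      have : 0 ≤ ‖h‖ ^ γ := by positivity
      nlinarith
  refine ⟨K, hK0, fun y hy z hz => ?_⟩
  by_cases hyz : y = z
  · subst hyz; simp; positivity
  have hpos : 0 < ‖y - z‖ := norm_pos_iff.2 (sub_ne_zero.2 hyz)
  obtain ⟨k, hk⟩ := pow_unbounded_of_one_lt (r / 4 / ‖y - z‖) (by norm_num : (1:ℝ) < 2)
  rw [div_lt_iff₀ hpos] at hk
  have := main k z (ball_subset_ball (by linarith) hz) (y - z) ?_ hk.le
  · simpa using this
  · rw [mem_ball] at hy hz
    rw [← dist_eq_norm]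
    linarith [dist_triangle_right y z x]

/-- Lipschitz with second differences of order `1 + δ`, near a point. -/
def C1d (δ : ℝ) (g : E → F) (x : E) : Prop :=
  ∃ L ≥ 0, ∃ s ∈ 𝓝 x, (∀ y ∈ s, ∀ z ∈ s, ‖g y - g z‖ ≤ L * ‖y - z‖) ∧
    ∀ a ∈ s, ∀ b ∈ s, ∀ c ∈ s, a + c = b + b →
      ‖g a + g c - (g b + g b)‖ ≤ L * ‖b - a‖ ^ (1 + δ)

lemma ZygAt.comp {σ δ : ℝ} (hσ : 0 < σ) (hσ1 : σ ≤ 1) (hδ : 0 < δ) {x : E} {g : E → F} {u : F → G}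
    (hu : ZygAt σ u (g x)) (hg : C1d δ g x) : ZygAt σ (fun y => u (g y)) x := by
  obtain ⟨C, hC, s, hs, hu⟩ := hu
  obtain ⟨L, hL, t, ht, hg1, hg2⟩ := hg
  obtain ⟨r₀, hr₀, hrs⟩ := Metric.mem_nhds_iff.1 hs
  set r := min r₀ 1
  have hr : 0 < r := lt_min hr₀ one_pos
  have hu := hu.mono le_rfl ((ball_subset_ball (min_le_left r₀ 1)).trans hrs)
  have hγ : 0 < σ / (1 + δ) := by positivity
  have hγσ : σ / (1 + δ) < σ := div_lt_self hσ (by linarith)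
  obtain ⟨K, hK, hKb⟩ := holder_improve hγ hγσ.le (by linarith) hC hr (min_le_right _ _) hu
  obtain ⟨h1, h2, h3⟩ := hu.mono le_rfl (ball_subset_ball (by linarith : r / 4 ≤ r))
  have hcont : ContinuousAt g x := by
    rw [ContinuousAt, tendsto_iff_norm_sub_tendsto_zero]
    refine squeeze_zero' (g := fun y => L * ‖y - x‖) (Eventually.of_forall fun y => norm_nonneg _)
      (by filter_upwards [ht] with y hy using hg1 y hy x (mem_of_mem_nhds ht)) ?_
    have : ContinuousAt (fun y : E => L * ‖y - x‖) x := by fun_prop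
    simpa using this.tendsto
  have hb : g ⁻¹' (ball (g x) (r / 4)) ∈ 𝓝 x := hcont (ball_mem_nhds _ (by positivity))
  refine ⟨C + C * L ^ (σ / 2) + C * L ^ σ + 2 * K * L ^ (σ / (1 + δ)), by positivity, _,
    inter_mem ht hb, fun y hy => ?_, fun y hy z hz => ?_, fun a ha b hb c hc e => ?_⟩
  · have : 0 ≤ C * L ^ (σ / 2) + C * L ^ σ + 2 * K * L ^ (σ / (1 + δ)) := by positivity
    linarith [h1 _ hy.2]
  · have i1 := h2 _ hy.2 _ hz.2
    have i2 : ‖g y - g z‖ ^ (σ / 2) ≤ L ^ (σ / 2) * ‖y - z‖ ^ (σ / 2) := by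
      rw [← Real.mul_rpow hL (norm_nonneg _)]
      exact Real.rpow_le_rpow (norm_nonneg _) (hg1 y hy.1 z hz.1) (by positivity)
    have : 0 ≤ (C + C * L ^ σ + 2 * K * L ^ (σ / (1 + δ))) * ‖y - z‖ ^ (σ / 2) := by positivity
    nlinarith [mul_le_mul_of_nonneg_left i2 hC]
  · have e2 : c - a = (2 : ℝ) • (b - a) := by
      rw [two_smul, eq_sub_of_add_eq' e]; abel
    set M : F := (2⁻¹ : ℝ) • (g a + g c) with hM
    have hMm : M ∈ ball (g x) (r / 4) := by
      have := (convex_ball (g x) (r / 4)) ha.2 hc.2 (by norm_num : (0:ℝ) ≤ 2⁻¹)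
        (by norm_num : (0:ℝ) ≤ 2⁻¹) (by norm_num)
      rwa [← smul_add] at this
    have eM : g a + g c = M + M := by
      rw [← two_smul ℝ M, hM, smul_smul]; norm_num
    have j1 := h3 _ ha.2 _ hMm _ hc.2 eM
    have j2 := hKb _ hMm _ hb.2
    have d1 : M - g a = (2⁻¹ : ℝ) • (g c - g a) := by
      have : g c = M + M - g a := by rw [← eM]; abel
      rw [this, show M + M - g a - g a = (2 : ℝ) • (M - g a) by rw [two_smul]; abel, smul_smul]
      norm_num
    have d2 : M - g b = (2⁻¹ : ℝ) • (g a + g c - (g b + g b)) := by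
      rw [eM, show M + M - (g b + g b) = (2 : ℝ) • (M - g b) by rw [two_smul]; abel, smul_smul]
      norm_num
    have n1 : ‖M - g a‖ ≤ L * ‖b - a‖ := by
      rw [d1, norm_smul]
      have := hg1 c hc.1 a ha.1
      rw [e2, norm_smul] at this
      norm_num at this ⊢
      linarith
    have n2 : ‖M - g b‖ ≤ L * ‖b - a‖ ^ (1 + δ) := by
      rw [d2, norm_smul]
      have := hg2 a ha.1 b hb.1 c hc.1 e
      have := norm_nonneg (g a + g c - (g b + g b))
      norm_num
      linarith
    have m1 : ‖M - g a‖ ^ σ ≤ L ^ σ * ‖b - a‖ ^ σ := by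
      rw [← Real.mul_rpow hL (norm_nonneg _)]
      exact Real.rpow_le_rpow (norm_nonneg _) n1 hσ.le
    have m2 : ‖M - g b‖ ^ (σ / (1 + δ)) ≤ L ^ (σ / (1 + δ)) * ‖b - a‖ ^ σ := by
      have : ‖b - a‖ ^ σ = (‖b - a‖ ^ (1 + δ)) ^ (σ / (1 + δ)) := by
        rw [← Real.rpow_mul (norm_nonneg _)]; congr 1; field_simp
      rw [this, ← Real.mul_rpow hL (by positivity)]
      exact Real.rpow_le_rpow (norm_nonneg _) n2 hγ.le
    have ee : u (g a) + u (g c) - (u (g b) + u (g b)) =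
        (u (g a) + u (g c) - (u M + u M)) + ((u M - u (g b)) + (u M - u (g b))) := by abel
    rw [ee]
    have := norm_add_le_of_le j1 (norm_add_le_of_le j2 j2)
    have : 0 ≤ (C + C * L ^ (σ / 2)) * ‖b - a‖ ^ σ := by positivity
    nlinarith [mul_le_mul_of_nonneg_left m1 hC, mul_le_mul_of_nonneg_left m2 hK]

lemma zygAt_of_lip {σ L : ℝ} (hσ : 0 < σ) (hσ1 : σ ≤ 1) {x : E} {g : E → F} {s : Set E}
    (hs : s ∈ 𝓝 x) (hL : 0 ≤ L) (h : ∀ y ∈ s, ∀ z ∈ s, ‖g y - g z‖ ≤ L * ‖y - z‖) :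
    ZygAt σ g x := by
  have hp : ∀ t τ : ℝ, 0 ≤ t → t ≤ 1 → 0 < τ → τ ≤ 1 → t ≤ t ^ τ := by
    intro t τ h0 h1 h2 h3
    rcases eq_or_lt_of_le h0 with h | h
    · rw [← h]; positivity
    · simpa using Real.rpow_le_rpow_of_exponent_ge h h1 h3
  have hx := mem_of_mem_nhds hs
  have hd : ∀ y ∈ ball x (1 / 2), ∀ z ∈ ball x (1 / 2), ‖y - z‖ ≤ 1 := by
    intro y hy z hz
    rw [mem_ball] at hy hz
    rw [← dist_eq_norm]
    linarith [dist_triangle_right y z x]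
  refine ⟨‖g x‖ + 2 * L, by positivity, s ∩ ball x (1 / 2),
    inter_mem hs (ball_mem_nhds _ (by norm_num)), fun y hy => ?_, fun y hy z hz => ?_,
    fun a ha b hb c hc e => ?_⟩
  · have i1 := h y hy.1 x hx
    have i2 := hd y hy.2 x (mem_ball_self (by norm_num))
    have i3 := norm_le_norm_add_norm_sub' (g y) (g x)
    nlinarith
  · have i1 := h y hy.1 z hz.1
    have i2 := hp _ (σ / 2) (norm_nonneg _) (hd y hy.2 z hz.2) (by linarith) (by linarith)
    have : 0 ≤ (‖g x‖ + L) * ‖y - z‖ ^ (σ / 2) := by positivity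
    nlinarith
  · have i1 := h a ha.1 b hb.1
    have i3 := h c hc.1 b hb.1
    have e2 : c - b = b - a := by rw [sub_eq_sub_iff_add_eq_add, ← e, add_comm]
    rw [e2] at i3
    rw [norm_sub_rev a b] at i1
    have i2 := hp _ σ (norm_nonneg _) (hd b hb.2 a ha.2) (by linarith) (by linarith)
    have ee : g a + g c - (g b + g b) = (g a - g b) + (g c - g b) := by abel
    rw [ee]
    have := norm_add_le_of_le i1 i3
    have : 0 ≤ ‖g x‖ * ‖b - a‖ ^ σ := by positivity
    nlinarith

lemma c1d_of_holder_fderiv {δ K L : ℝ} (hδ : 0 < δ) {x : E} {g : E → F} {s : Set E}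
    (hs : s ∈ 𝓝 x) (hK : 0 ≤ K) (hd : ∀ y ∈ s, DifferentiableAt ℝ g y)
    (hh : ∀ y ∈ s, ∀ z ∈ s, ‖fderiv ℝ g y - fderiv ℝ g z‖ ≤ K * ‖y - z‖ ^ δ)
    (hL : 0 ≤ L) (h : ∀ y ∈ s, ∀ z ∈ s, ‖g y - g z‖ ≤ L * ‖y - z‖) : C1d δ g x := by
  obtain ⟨r, hr, hrs⟩ := Metric.mem_nhds_iff.1 hs
  refine ⟨L + 2 * K, by positivity, ball x r, ball_mem_nhds _ hr, fun y hy z hz => ?_,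
    fun a ha b hb c hc e => ?_⟩
  · have := h y (hrs hy) z (hrs hz)
    have : 0 ≤ 2 * K * ‖y - z‖ := by positivity
    linarith
  · have tay : ∀ b ∈ ball x r, ∀ c ∈ ball x r,
        ‖g c - g b - fderiv ℝ g b (c - b)‖ ≤ K * ‖c - b‖ ^ δ * ‖c - b‖ := by
      intro b hb c hc
      have hseg : segment ℝ b c ⊆ ball x r := (convex_ball x r).segment_subset hb hc
      refine (convex_segment b c).norm_image_sub_le_of_norm_hasFDerivWithin_le'
        (f' := fderiv ℝ g)
        (fun z hz => (hd z (hrs (hseg hz))).hasFDerivAt.hasFDerivWithinAt) (fun z hz => ?_)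
        (left_mem_segment ℝ b c) (right_mem_segment ℝ b c)
      refine (hh z (hrs (hseg hz)) b (hrs hb)).trans ?_
      have : ‖z - b‖ ≤ ‖c - b‖ := by
        have := norm_sub_le_of_mem_segment hz
        simpa using this
      gcongr
    have t1 := tay b hb a ha
    have t2 := tay b hb c hc
    have e2 : c - b = b - a := by rw [sub_eq_sub_iff_add_eq_add, ← e, add_comm]
    have e3 : a - b = -(b - a) := by abel
    rw [e2] at t2
    rw [e3, norm_neg, map_neg] at t1
    have ee : g a + g c - (g b + g b) = (g a - g b - -fderiv ℝ g b (b - a))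
      + (g c - g b - fderiv ℝ g b (b - a)) := by abel
    rw [ee, Real.rpow_add_of_nonneg (norm_nonneg _) (by norm_num) hδ.le, Real.rpow_one]
    have := norm_add_le_of_le t1 t2
    have : 0 ≤ L * (‖b - a‖ * ‖b - a‖ ^ δ) := by positivity
    nlinarith

end base

section LZ
variable {E F G H : Type} [NormedAddCommGroup E] [NormedSpace ℝ E]
  [NormedAddCommGroup F] [NormedSpace ℝ F] [NormedAddCommGroup G] [NormedSpace ℝ G]
  [NormedAddCommGroup H] [NormedSpace ℝ H]

/-- Locally Zygmund of order `k + σ`. -/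
def LZ (σ : ℝ) (k : ℕ) (u : E → F) (U : Set E) : Prop :=
  ContDiffOn ℝ k u U ∧ ∀ i ≤ k, ∀ x ∈ U, ZygAt σ (iteratedFDeriv ℝ i u) x

lemma zygAt_iter_zero {σ : ℝ} {u : E → F} {x : E} :
    ZygAt σ (iteratedFDeriv ℝ 0 u) x ↔ ZygAt σ u x := by
  rw [iteratedFDeriv_zero_eq_comp]
  exact ZygAt.isom (continuousMultilinearCurryFin0 ℝ E F).symm

lemma zygAt_iter_succ {σ : ℝ} {u : E → F} {x : E} {i : ℕ} :
    ZygAt σ (iteratedFDeriv ℝ (i + 1) u) x ↔ ZygAt σ (iteratedFDeriv ℝ i (fderiv ℝ u)) x := by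
  have : iteratedFDeriv ℝ (i + 1) u = fun y => (continuousMultilinearCurryRightEquiv' ℝ i E F).symm
      (iteratedFDeriv ℝ i (fderiv ℝ u) y) := by
    funext y
    exact iteratedFDeriv_succ_eq_comp_right
  rw [this]
  exact ZygAt.isom' (fun z => (continuousMultilinearCurryRightEquiv' ℝ i E F).symm z)
    (fun a b => LinearIsometryEquiv.map_add _ a b) (fun a => LinearIsometryEquiv.norm_map _ a)

lemma lz_zero {σ : ℝ} (hσ : 0 < σ) {u : E → F} {U : Set E} :
    LZ σ 0 u U ↔ ∀ x ∈ U, ZygAt σ u x := by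
  constructor
  · intro h x hx
    exact zygAt_iter_zero.1 (h.2 0 le_rfl x hx)
  · intro h
    refine ⟨?_, fun i hi x hx => ?_⟩
    · simp only [Nat.cast_zero, contDiffOn_zero]
      exact fun x hx => (h x hx).continuousAt hσ |>.continuousWithinAt
    · obtain rfl : i = 0 := by omega
      exact zygAt_iter_zero.2 (h x hx)

lemma lz_succ {σ : ℝ} {k : ℕ} {u : E → F} {U : Set E} (hU : IsOpen U) :
    LZ σ (k + 1) u U ↔ (∀ x ∈ U, ZygAt σ u x) ∧ (∀ x ∈ U, DifferentiableAt ℝ u x) ∧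
      LZ σ k (fderiv ℝ u) U := by
  have hcd : ContDiffOn ℝ ((k + 1 : ℕ) : WithTop ℕ∞) u U ↔ (∀ x ∈ U, DifferentiableAt ℝ u x) ∧
      ContDiffOn ℝ k (fderiv ℝ u) U := by
    push_cast
    rw [contDiffOn_succ_iff_fderiv_of_isOpen hU]
    constructor
    · rintro ⟨h1, -, h2⟩
      exact ⟨fun x hx => (h1 x hx).differentiableAt (hU.mem_nhds hx), h2⟩
    · rintro ⟨h1, h2⟩
      exact ⟨fun x hx => (h1 x hx).differentiableWithinAt, by simp, h2⟩
  constructor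
  · rintro ⟨h1, h2⟩
    exact ⟨fun x hx => zygAt_iter_zero.1 (h2 0 (by omega) x hx), (hcd.1 h1).1, (hcd.1 h1).2,
      fun i hi x hx => zygAt_iter_succ.1 (h2 (i + 1) (by omega) x hx)⟩
  · rintro ⟨h1, h2, h3, h4⟩
    refine ⟨hcd.2 ⟨h2, h3⟩, fun i hi x hx => ?_⟩
    cases i with
    | zero => exact zygAt_iter_zero.2 (h1 x hx)
    | succ i => exact zygAt_iter_succ.2 (h4 i (by omega) x hx)

lemma LZ.mono {σ : ℝ} {k l : ℕ} {u : E → F} {U : Set E} (h : LZ σ k u U) (hl : l ≤ k) :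
    LZ σ l u U :=
  ⟨h.1.of_le (by exact_mod_cast hl), fun i hi => h.2 i (hi.trans hl)⟩

lemma LZ.zygAt {σ : ℝ} {k : ℕ} {u : E → F} {U : Set E} (h : LZ σ k u U) :
    ∀ x ∈ U, ZygAt σ u x := fun x hx => zygAt_iter_zero.1 (h.2 0 (Nat.zero_le _) x hx)

lemma LZ.congr {σ : ℝ} {k : ℕ} {u v : E → F} {U : Set E} (hU : IsOpen U) (h : LZ σ k u U)
    (e : EqOn v u U) : LZ σ k v U :=
  ⟨h.1.congr e, fun i hi x hx => (h.2 i hi x hx).congr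
    (Filter.EventuallyEq.iteratedFDeriv ℝ (e.eventuallyEq_of_mem (hU.mem_nhds hx)) i)⟩

lemma LZ.add {σ : ℝ} (hσ : 0 < σ) {k : ℕ} {u v : E → F} {U : Set E} (hU : IsOpen U)
    (h : LZ σ k u U) (h' : LZ σ k v U) : LZ σ k (fun y => u y + v y) U := by
  induction k generalizing F with
  | zero =>
    exact (lz_zero hσ).2 fun x hx => (h.zygAt x hx).add (h'.zygAt x hx)
  | succ k ih =>
    obtain ⟨h1, h2, h3⟩ := (lz_succ hU).1 h
    obtain ⟨h1', h2', h3'⟩ := (lz_succ hU).1 h'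
    refine (lz_succ hU).2 ⟨fun x hx => (h1 x hx).add (h1' x hx),
      fun x hx => (h2 x hx).add (h2' x hx), (ih h3 h3').congr hU fun x hx => ?_⟩
    exact fderiv_add (h2 x hx) (h2' x hx)

lemma LZ.bilin {σ : ℝ} (hσ : 0 < σ) {k : ℕ} {u : E → F} {v : E → G} {U : Set E} (hU : IsOpen U)
    (B : F →L[ℝ] G →L[ℝ] H) (h : LZ σ k u U) (h' : LZ σ k v U) :
    LZ σ k (fun y => B (u y) (v y)) U := by
  induction k generalizing F G H with
  | zero =>
    exact (lz_zero hσ).2 fun x hx => (h.zygAt x hx).bilin hσ B (h'.zygAt x hx)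
  | succ k ih =>
    obtain ⟨h1, h2, h3⟩ := (lz_succ hU).1 h
    obtain ⟨h1', h2', h3'⟩ := (lz_succ hU).1 h'
    have hd : ∀ x ∈ U, HasFDerivAt (fun y => B (u y) (v y))
        (B.precompR E (u x) (fderiv ℝ v x) + B.precompL E (fderiv ℝ u x) (v x)) x :=
      fun x hx => B.hasFDerivAt_of_bilinear (h2 x hx).hasFDerivAt (h2' x hx).hasFDerivAt
    refine (lz_succ hU).2 ⟨fun x hx => (h1 x hx).bilin hσ B (h1' x hx),
      fun x hx => (hd x hx).differentiableAt, ?_⟩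
    have a1 := ih (B.precompR E) (h.mono (Nat.le_succ k)) h3'
    have a2 := ih (B.precompL E) h3 (h'.mono (Nat.le_succ k))
    exact (a1.add hσ hU a2).congr hU fun x hx => (hd x hx).fderiv

lemma LZ.comp {σ δ : ℝ} (hσ : 0 < σ) (hσ1 : σ ≤ 1) (hδ : 0 < δ) {k : ℕ} {u : F → G} {g : E → F}
    {U : Set E} {V : Set F} (hU : IsOpen U) (hV : IsOpen V) (hm : MapsTo g U V)
    (h : LZ σ k u V) (hg : LZ σ k g U) (hg1 : ∀ x ∈ U, C1d δ g x) :
    LZ σ k (fun y => u (g y)) U := by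
  induction k generalizing G with
  | zero =>
    exact (lz_zero hσ).2 fun x hx => (h.zygAt _ (hm hx)).comp hσ hσ1 hδ (hg1 x hx)
  | succ k ih =>
    obtain ⟨h1, h2, h3⟩ := (lz_succ hV).1 h
    obtain ⟨h1', h2', h3'⟩ := (lz_succ hU).1 hg
    have hd : ∀ x ∈ U, HasFDerivAt (fun y => u (g y))
        ((fderiv ℝ u (g x)).comp (fderiv ℝ g x)) x :=
      fun x hx => (h2 _ (hm hx)).hasFDerivAt.comp x (h2' x hx).hasFDerivAt
    refine (lz_succ hU).2 ⟨fun x hx => (h1 _ (hm hx)).comp hσ hσ1 hδ (hg1 x hx),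
      fun x hx => (hd x hx).differentiableAt, ?_⟩
    exact ((ih h3 (hg.mono (Nat.le_succ k))).bilin hσ hU
      (ContinuousLinearMap.compL ℝ E F G) h3').congr hU fun x hx => (hd x hx).fderiv

lemma LZ.inv {R : Type} [NormedRing R] [NormedAlgebra ℝ R] [CompleteSpace R] {σ : ℝ} (hσ : 0 < σ)
    {k : ℕ} {A I : E → R} {U : Set E} (hU : IsOpen U) (h : LZ σ k A U)
    (hI : ContinuousOn I U)
    (hl : ∀ y ∈ U, I y * A y = 1) (hr : ∀ y ∈ U, A y * I y = 1) : LZ σ k I U := by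
  have hz : ∀ x ∈ U, ZygAt σ I x := by
    intro x hx
    have hx' := hU.mem_nhds hx
    have hc : ContinuousAt (fun y => ‖I y‖) x := (hI.continuousAt hx').norm
    exact (h.zygAt x hx).inv hσ (M := ‖I x‖ + 1)
      ((hc.eventually_lt continuousAt_const (by linarith)).mono fun y hy => hy.le)
      (by filter_upwards [hx'] with y hy using hl y hy)
      (by filter_upwards [hx'] with y hy using hr y hy)
  induction k with
  | zero => exact (lz_zero hσ).2 hz
  | succ k ih =>
    obtain ⟨h1, h2, h3⟩ := (lz_succ hU).1 h
    have hLI := ih (h.mono (Nat.le_succ k))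
    have hd : ∀ x ∈ U, HasFDerivAt I
        ((-ContinuousLinearMap.mulLeftRight ℝ R (I x) (I x)).comp (fderiv ℝ A x)) x := by
      intro x hx
      let a : Rˣ := ⟨A x, I x, hr x hx, hl x hx⟩
      have e1 : HasFDerivAt Ring.inverse (-ContinuousLinearMap.mulLeftRight ℝ R (I x) (I x)) (A x) :=
        hasFDerivAt_ringInverse (𝕜 := ℝ) a
      refine (e1.comp x (h2 x hx).hasFDerivAt).congr_of_eventuallyEq ?_
      filter_upwards [hU.mem_nhds hx] with y hy
      let b : Rˣ := ⟨A y, I y, hr y hy, hl y hy⟩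
      exact (Ring.inverse_unit b).symm
    refine (lz_succ hU).2 ⟨hz, fun x hx => (hd x hx).differentiableAt, ?_⟩
    exact ((hLI.bilin hσ hU (-ContinuousLinearMap.mulLeftRight ℝ R) hLI).bilin hσ hU
      (ContinuousLinearMap.compL ℝ E R R) h3).congr hU fun x hx => (hd x hx).fderiv

/-- The inverse of an `LZ` map. -/
lemma LZ.inverse [CompleteSpace E] {σ : ℝ} (hσ : 0 < σ) (hσ1 : σ ≤ 1) {m : ℕ} (hm : 1 ≤ m)
    {f g : E → E} {U V : Set E} (hU : IsOpen U) (hV : IsOpen V) (hfm : MapsTo f U V)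
    (hgm : MapsTo g V U) (hinv : InvOn g f U V) (hf : LZ σ m f U) (hgC : ContDiffOn ℝ 1 g V) :
    LZ σ m g V := by
  obtain ⟨m, rfl⟩ : ∃ k, m = k + 1 := ⟨m - 1, by omega⟩
  obtain ⟨hf1, hf2, hf3⟩ := (lz_succ hU).1 hf
  have hg2 : ∀ y ∈ V, DifferentiableAt ℝ g y := fun y hy =>
    (hgC.differentiableOn one_ne_zero).differentiableAt (hV.mem_nhds hy)
  have hlr : ∀ y ∈ V, fderiv ℝ g y * fderiv ℝ f (g y) = 1 ∧
      fderiv ℝ f (g y) * fderiv ℝ g y = 1 := by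
    intro y hy
    have hx := hgm hy
    have efg : f (g y) = y := hinv.2 hy
    have dg := (hg2 y hy).hasFDerivAt
    have df := (hf2 _ hx).hasFDerivAt
    constructor
    · have dg' : HasFDerivAt g (fderiv ℝ g y) (f (g y)) := by rw [efg]; exact dg
      refine (dg'.comp _ df).unique ((hasFDerivAt_id (g y)).congr_of_eventuallyEq ?_)
      filter_upwards [hU.mem_nhds hx] with z hz using hinv.1 hz
    · refine (df.comp _ dg).unique ((hasFDerivAt_id y).congr_of_eventuallyEq ?_)
      filter_upwards [hV.mem_nhds hy] with z hz using hinv.2 hz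
  have hDg : ContinuousOn (fderiv ℝ g) V := hgC.continuousOn_fderiv_of_isOpen hV le_rfl
  have hlip : ∀ y ∈ V, ∃ L ≥ 0, ∃ s ∈ 𝓝 y, ∀ a ∈ s, ∀ b ∈ s, ‖g a - g b‖ ≤ L * ‖a - b‖ := by
    intro y hy
    obtain ⟨K, t, ht, hK⟩ := (hgC.contDiffAt (hV.mem_nhds hy)).exists_lipschitzOnWith
    exact ⟨K, K.2, t, ht, fun a ha b hb => hK.norm_sub_le ha hb⟩
  have hC1 : ∀ y ∈ V, C1d (σ / 2) g y := by
    intro y hy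
    obtain ⟨L, hL, s, hs, hLs⟩ := hlip y hy
    obtain ⟨C, hC, t, ht, -, hh, -⟩ := hf3.zygAt (g y) (hgm hy)
    have hgc : ContinuousAt g y := (hg2 y hy).continuousAt
    have hc : ContinuousAt (fun y => ‖fderiv ℝ g y‖) y := (hDg.continuousAt (hV.mem_nhds hy)).norm
    have hM := hc.eventually_lt (continuousAt_const (y := ‖fderiv ℝ g y‖ + 1)) (by linarith)
    set M := ‖fderiv ℝ g y‖ + 1 with hM'
    have hM0 : 0 ≤ M := by positivity
    have hw : s ∩ V ∩ g ⁻¹' t ∩ {z | ‖fderiv ℝ g z‖ < M} ∈ 𝓝 y :=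
      inter_mem (inter_mem (inter_mem hs (hV.mem_nhds hy)) (hgc ht)) hM
    refine c1d_of_holder_fderiv (K := M * (C * L ^ (σ / 2)) * M) (L := L) (by positivity) hw
      (by positivity) (fun z hz => hg2 z hz.1.1.2) (fun a ha b hb => ?_) hL
      (fun a ha b hb => hLs a ha.1.1.1 b hb.1.1.1)
    have e : fderiv ℝ g a - fderiv ℝ g b =
        -(fderiv ℝ g a * (fderiv ℝ f (g a) - fderiv ℝ f (g b)) * fderiv ℝ g b) := by
      rw [mul_sub, sub_mul, (hlr a ha.1.1.2).1, mul_assoc, (hlr b hb.1.1.2).2]; simp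
    rw [e, norm_neg]
    have i1 : ‖fderiv ℝ f (g a) - fderiv ℝ f (g b)‖ ≤ C * (L ^ (σ / 2) * ‖a - b‖ ^ (σ / 2)) := by
      refine (hh _ ha.1.2 _ hb.1.2).trans ?_
      rw [← Real.mul_rpow hL (norm_nonneg _)]
      have := hLs a ha.1.1.1 b hb.1.1.1
      gcongr
    calc _ ≤ ‖fderiv ℝ g a‖ * ‖fderiv ℝ f (g a) - fderiv ℝ f (g b)‖ * ‖fderiv ℝ g b‖ :=
          (norm_mul_le _ _).trans (by gcongr; exact norm_mul_le _ _)
      _ ≤ M * (C * (L ^ (σ / 2) * ‖a - b‖ ^ (σ / 2))) * M := by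
          have h1 : ‖fderiv ℝ g a‖ ≤ M := le_of_lt ha.2
          have h2 : ‖fderiv ℝ g b‖ ≤ M := le_of_lt hb.2
          gcongr
      _ = _ := by ring
  have hz : ∀ y ∈ V, ZygAt σ g y := by
    intro y hy
    obtain ⟨L, hL, s, hs, hLs⟩ := hlip y hy
    exact zygAt_of_lip hσ hσ1 hs hL hLs
  have main : ∀ k ≤ m + 1, LZ σ k g V := by
    intro k
    induction k with
    | zero => intro _; exact (lz_zero hσ).2 hz
    | succ k ih =>
      intro hk
      have hk' := ih (by omega)
      have hA : LZ σ k (fun y => fderiv ℝ f (g y)) V :=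
        LZ.comp hσ hσ1 (by positivity : 0 < σ / 2) hV hU hgm (hf3.mono (by omega)) hk' hC1
      exact (lz_succ hV).2 ⟨hz, hg2, hA.inv hσ hV hDg (fun y hy => (hlr y hy).1)
        (fun y hy => (hlr y hy).2)⟩
  exact main _ le_rfl

lemma zygBase_bounds {σ : ℝ} (hσ : 0 < σ) {Ω : Set E} {u : E → F} (h : zygBase σ Ω u ≠ ⊤) :
    ∃ C ≥ 0, ZB σ C Ω u := by
  have hle : ∀ (a : ℝ) (b : ℝ≥0∞), b ≤ zygBase σ Ω u → ENNReal.ofReal a ≤ b →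
      a ≤ (zygBase σ Ω u).toReal := by
    intro a b hb hab
    exact (ENNReal.ofReal_le_iff_le_toReal h).1 (hab.trans hb)
  have l1 : (⨆ x ∈ Ω, ENNReal.ofReal ‖u x‖) ≤ zygBase σ Ω u := by
    unfold zygBase holderNorm
    rw [add_assoc]
    exact le_self_add
  have l2 : (⨆ (x ∈ Ω) (y ∈ Ω) (_ : x ≠ y), ENNReal.ofReal (‖u x - u y‖ / ‖x - y‖ ^ (σ / 2)))
      ≤ zygBase σ Ω u := by
    unfold zygBase holderNorm
    exact le_add_self.trans le_self_add
  have l3 : secondDiff σ Ω u ≤ zygBase σ Ω u := by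
    unfold zygBase
    exact le_add_self
  refine ⟨(zygBase σ Ω u).toReal, ENNReal.toReal_nonneg, fun y hy => ?_, fun y hy z hz => ?_,
    fun a ha b hb c hc e => ?_⟩
  · exact hle _ _ l1 (le_iSup₂_of_le y hy le_rfl)
  · by_cases hyz : y = z
    · subst hyz; simp; positivity
    have hpos : 0 < ‖y - z‖ := norm_pos_iff.2 (sub_ne_zero.2 hyz)
    rw [← div_le_iff₀ (by positivity)]
    exact hle _ _ l2 (le_iSup₂_of_le y hy (le_iSup₂_of_le z hz (le_iSup_of_le hyz le_rfl)))
  · by_cases hab : b = a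
    · subst hab
      obtain rfl : c = b := add_left_cancel e
      simp; positivity
    have hne : b - a ≠ 0 := sub_ne_zero.2 hab
    have hpos : 0 < ‖b - a‖ := norm_pos_iff.2 hne
    have e1 : a + (b - a) = b := by abel
    have e2 : a + 2 • (b - a) = c := by
      rw [eq_sub_of_add_eq' e, two_smul]; abel
    have e3 : u a + u c - (u b + u b) = u (a + 2 • (b - a)) - 2 • u (a + (b - a)) + u a := by
      rw [e1, e2, two_smul]; abel
    rw [← div_le_iff₀ (by positivity), e3]
    refine hle _ _ l3 ?_
    unfold secondDiff
    exact le_iSup_of_le a (le_iSup_of_le (b - a) (le_iSup_of_le hne (le_iSup_of_le ha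
      (le_iSup_of_le (by rwa [e1]) (le_iSup_of_le (by rwa [e2]) le_rfl)))))

lemma zygBase_ne_top {σ C : ℝ} (hσ : 0 < σ) {Ω : Set E} {u : E → F} (h : ZB σ C Ω u) :
    zygBase σ Ω u ≠ ⊤ := by
  obtain ⟨h1, h2, h3⟩ := h
  have : zygBase σ Ω u ≤ ENNReal.ofReal C + ENNReal.ofReal C + ENNReal.ofReal C := by
    unfold zygBase holderNorm secondDiff
    refine add_le_add (add_le_add ?_ ?_) ?_
    · exact iSup₂_le fun y hy => ENNReal.ofReal_le_ofReal (h1 y hy)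
    · refine iSup₂_le fun y hy => iSup₂_le fun z hz => iSup_le fun hyz => ENNReal.ofReal_le_ofReal ?_
      have hpos : 0 < ‖y - z‖ := norm_pos_iff.2 (sub_ne_zero.2 hyz)
      rw [div_le_iff₀ (by positivity)]
      exact h2 y hy z hz
    · refine iSup_le fun x => iSup_le fun v => iSup_le fun hv => iSup_le fun a => iSup_le fun b =>
        iSup_le fun c => ENNReal.ofReal_le_ofReal ?_
      have hpos : 0 < ‖v‖ := norm_pos_iff.2 hv
      rw [div_le_iff₀ (by positivity)]
      have := h3 _ a _ b _ c (by rw [two_smul]; abel)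
      rw [add_sub_cancel_left] at this
      refine le_trans (le_of_eq ?_) this
      congr 1
      rw [two_smul ℕ (u _)]; abel
  exact ne_top_of_le_ne_top (by simp) this

end LZ

lemma ceil_facts {s : ℝ} (hs : 1 < s) : ∃ m : ℕ, 1 ≤ m ∧ ⌈s⌉₊ = m + 1 ∧ 0 < s - m ∧ s - m ≤ 1 := by
  have h1 : 1 < ⌈s⌉₊ := Nat.lt_ceil.2 (by simpa using hs)
  obtain ⟨m, hm⟩ : ∃ m, ⌈s⌉₊ = m + 1 := ⟨⌈s⌉₊ - 1, by omega⟩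
  refine ⟨m, by omega, hm, ?_, ?_⟩
  · have : m < ⌈s⌉₊ := by omega
    have := Nat.lt_ceil.1 this
    linarith
  · have := Nat.le_ceil s
    rw [hm] at this
    push_cast at this
    linarith

lemma locZyg_iff {E F : Type} [NormedAddCommGroup E] [NormedSpace ℝ E]
    [NormedAddCommGroup F] [NormedSpace ℝ F] {s : ℝ} {m : ℕ} (hm : ⌈s⌉₊ = m + 1) (h0 : 0 < s - m)
    {U : Set E} (hU : IsOpen U) {f : E → F} : LocZyg s U f ↔ LZ (s - m) m f U := by
  constructor
  · intro h
    refine ⟨fun x hx => ?_, fun i hi x hx => ?_⟩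
    · obtain ⟨ε, hε, hb, h1, h2⟩ := h x hx
      rw [hm, Nat.add_sub_cancel] at h1
      exact (h1.contDiffAt (ball_mem_nhds x hε)).contDiffWithinAt
    · obtain ⟨ε, hε, hb, h1, h2⟩ := h x hx
      unfold zygNorm at h2
      rw [hm, Nat.add_sub_cancel] at h2
      have h3 := (ENNReal.sum_ne_top.1 h2) i (Finset.mem_range.2 (by omega))
      obtain ⟨C, hC, h4⟩ := zygBase_bounds h0 h3
      exact ⟨C, hC, _, ball_mem_nhds x hε,
        h4.congr fun y hy => (iteratedFDerivWithin_of_isOpen i isOpen_ball hy).symm⟩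
  · rintro ⟨h1, h2⟩ x hx
    have key : ∀ i ∈ Finset.range (m + 1), ∀ᶠ r in 𝓝[>] (0 : ℝ),
        ∃ C, ZB (s - m) C (ball x r) (iteratedFDeriv ℝ i f) := by
      intro i hi
      obtain ⟨C, hC, t, ht, h⟩ := h2 i (by have := Finset.mem_range.1 hi; omega) x hx
      obtain ⟨r, hr, hrt⟩ := Metric.mem_nhds_iff.1 ht
      filter_upwards [Ioo_mem_nhdsGT hr] with r' hr'
      exact ⟨C, h.mono le_rfl ((ball_subset_ball hr'.2.le).trans hrt)⟩
    have key2 := (Finset.eventually_all _).2 key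
    obtain ⟨r, hr, hrU⟩ := Metric.mem_nhds_iff.1 (hU.mem_nhds hx)
    have key3 : ∀ᶠ z in 𝓝[>] (0 : ℝ), z ∈ Ioo 0 r := Ioo_mem_nhdsGT hr
    obtain ⟨ε, hε, hk⟩ := (key3.and key2).exists
    have hεU : ball x ε ⊆ U := (ball_subset_ball hε.2.le).trans hrU
    refine ⟨ε, hε.1, hεU, ?_, ?_⟩
    · rw [hm, Nat.add_sub_cancel]
      exact h1.mono hεU
    · unfold zygNorm
      rw [hm, Nat.add_sub_cancel]
      refine ENNReal.sum_ne_top.2 fun i hi => ?_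
      obtain ⟨C, hC⟩ := hk i hi
      exact zygBase_ne_top h0 (hC.congr (iteratedFDerivWithin_of_isOpen i isOpen_ball))

end ZygInv

/-- Inverses of locally Zygmund maps. For `s > 1`, if `f : U₁ → U₂` is a locally
`𝒞^s` map between open subsets of `ℝ^n` which is also a `C¹` diffeomorphism (with inverse `g`),
then `f⁻¹ = g : U₂ → U₁` is locally `𝒞^s`. -/
theorem locZyg_inverse (n : ℕ) (s : ℝ) (hs : 1 < s)
    (U₁ U₂ : Set (EuclideanSpace ℝ (Fin n))) (hU₁ : IsOpen U₁) (hU₂ : IsOpen U₂)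
    (f g : EuclideanSpace ℝ (Fin n) → EuclideanSpace ℝ (Fin n))
    (hbij : Set.BijOn f U₁ U₂) (hf : LocZyg s U₁ f)
    (hfC1 : ContDiffOn ℝ 1 f U₁)
    (hinv : Set.InvOn g f U₁ U₂) (hgC1 : ContDiffOn ℝ 1 g U₂) :
    LocZyg s U₂ g := by

  obtain ⟨m, hm1, hm, h0, h1⟩ := ZygInv.ceil_facts hs
  rw [ZygInv.locZyg_iff hm h0 hU₂]
  have hgm : Set.MapsTo g U₂ U₁ := by
    intro y hy
    obtain ⟨x, hx, rfl⟩ := hbij.surjOn hy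
    rw [hinv.1 hx]
    exact hx
  exact ((ZygInv.locZyg_iff hm h0 hU₁).1 hf).inverse h0 h1 hm1 hU₁ hU₂ hbij.mapsTo hgm hinv hgC1
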